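/- For integers k ≥ i ≥ 1 and complex q with 0 < |q| < 1, Σ_{n,j≥0} Ē_{k,i}(n,j) q^{2n−j} = (q²;q⁴)_∞ · (q^{2i−1}, q^{4k+1−2i}, q^{4k}; q^{4k})_∞ / (q;q)_∞. -/

import Mathlib

namespace Paper

/-- The four kinds of unitary steps. -/
inductive PStep : Type
  | NE | SE | S | E
  deriving DecidableEq, BEq, Repr

/-- Horizontal displacement of a step. -/
def stepDx : PStep → ℕ
  | .S => 0
  | _ => 1

/-- Vertical displacement of a step. -/
def stepDy : PStep → ℤ
  | .NE => 1
  | .SE => -1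
  | .S => -1
  | .E => 0

/-- Height (`y`-coordinate) after performing the steps of `l`, starting at height `h`. -/
def pathHeight (h : ℕ) (l : List PStep) : ℤ := (h : ℤ) + (l.map stepDy).sum

/-- `x`-coordinate after performing the steps of `l`, starting on the `y`-axis. -/
def pathX (l : List PStep) : ℕ := (l.map stepDx).sum

/-- A valid path: stays in the first quadrant, starts at `(0,h)` on the `y`-axis, ends
on the `x`-axis, South steps only appear directly after a North-East step, East steps
only appear at height `0`, and the path is empty or ends with a South-East or South step. -/
def ValidPath (h : ℕ) (l : List PStep) : Prop :=
  (∀ m : ℕ, 0 ≤ pathHeight h (l.take m)) ∧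
  (∀ m : ℕ, l[m]? = some PStep.S → ∃ m', m = m' + 1 ∧ l[m']? = some PStep.NE) ∧
  (∀ m : ℕ, l[m]? = some PStep.E → pathHeight h (l.take m) = 0) ∧
  pathHeight h l = 0 ∧
  (l = [] ∨ l.getLast? = some PStep.SE ∨ l.getLast? = some PStep.S)

/-- The vertex reached after step `m` is a peak: it is preceded by a North-East step and
followed by a South-East step (NESE peak) or a South step (NES peak). -/
def IsPeak (l : List PStep) (m : ℕ) : Prop :=
  l[m]? = some PStep.NE ∧ (l[m+1]? = some PStep.SE ∨ l[m+1]? = some PStep.S)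

instance (l : List PStep) (m : ℕ) : Decidable (IsPeak l m) := by
  unfold IsPeak; infer_instance

/-- The major index of a path: the sum of the `x`-coordinates of its peaks. -/
def majorIndex (l : List PStep) : ℕ :=
  ∑ m ∈ Finset.range l.length, if IsPeak l m then pathX (l.take (m + 1)) else 0

/-- The number of peaks of a path. -/
def numPeaks (l : List PStep) : ℕ :=
  ((Finset.range l.length).filter fun m => IsPeak l m).card

/-- The number of South steps of a path. -/
def southSteps (l : List PStep) : ℕ := l.count PStep.S

/-- A path satisfies the special `(k,i)`-conditions if it is a valid path starting at
height `k - i` whose height always stays below `k`. -/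
def SpecialPath (k i : ℕ) (l : List PStep) : Prop :=
  ValidPath (k - i) l ∧ ∀ m : ℕ, pathHeight (k - i) (l.take m) < k

/-- `Ebar k i n j` is the number of paths with major index `n` and `j` South steps
satisfying the special `(k,i)`-conditions. -/
noncomputable def Ebar (k i n j : ℕ) : ℕ :=
  Nat.card {l : List PStep // SpecialPath k i l ∧ majorIndex l = n ∧ southSteps l = j}


open scoped Classical

/-- The infinite q-Pochhammer symbol `(x;q)_∞ = ∏_{i≥0} (1 - x qⁱ)`. -/
noncomputable def qPochInf (x q : ℂ) : ℂ := ∏' i : ℕ, (1 - x * q ^ i)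

/-- The finite q-Pochhammer symbol `(x;q)_N = ∏_{i=0}^{N-1} (1 - x qⁱ)`. -/
noncomputable def qPochN (x q : ℂ) (N : ℕ) : ℂ := ∏ i ∈ Finset.range N, (1 - x * q ^ i)

/-- The q-Pochhammer symbol with arbitrary integer index,
`(x;q)_n = (x;q)_∞ / (x qⁿ;q)_∞`. -/
noncomputable def qPochZ (x q : ℂ) (n : ℤ) : ℂ := qPochInf x q / qPochInf (x * q ^ n) q


open Filter Topology

/-! ### Infinite and finite `q`-Pochhammer symbols -/

lemma summable_norm_qPoch (x : ℂ) {q : ℂ} (hq : ‖q‖ < 1) :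
    Summable fun i : ℕ => ‖-(x * q ^ i)‖ := by
  simpa using (summable_geometric_of_lt_one (norm_nonneg q) hq).mul_left ‖x‖

lemma multipliable_qPoch (x : ℂ) {q : ℂ} (hq : ‖q‖ < 1) :
    Multipliable fun i : ℕ => 1 - x * q ^ i := by
  simpa [sub_eq_add_neg] using multipliable_one_add_of_summable (summable_norm_qPoch x hq)

lemma tendsto_qPochN (x : ℂ) {q : ℂ} (hq : ‖q‖ < 1) :
    Tendsto (qPochN x q) atTop (𝓝 (qPochInf x q)) :=
  (multipliable_qPoch x hq).hasProd.tendsto_prod_nat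

lemma one_sub_mul_pow_ne_zero {x q : ℂ} (hx : ‖x‖ < 1) (hq : ‖q‖ < 1) (i : ℕ) :
    1 - x * q ^ i ≠ 0 := by
  intro h
  have h1 : ‖x * q ^ i‖ = 1 := by rw [← sub_eq_zero.mp h, norm_one]
  rw [norm_mul, norm_pow] at h1
  have h2 : ‖q‖ ^ i ≤ 1 := pow_le_one₀ (norm_nonneg _) hq.le
  nlinarith [norm_nonneg x]

lemma qPochN_ne_zero {x q : ℂ} (hx : ‖x‖ < 1) (hq : ‖q‖ < 1) (N : ℕ) : qPochN x q N ≠ 0 :=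
  Finset.prod_ne_zero_iff.mpr fun i _ => one_sub_mul_pow_ne_zero hx hq i

lemma qPochInf_ne_zero {x q : ℂ} (hx : ‖x‖ < 1) (hq : ‖q‖ < 1) : qPochInf x q ≠ 0 := by
  have h := tprod_one_add_ne_zero_of_summable (f := fun i : ℕ => -(x * q ^ i))
    (fun i => by simpa [sub_eq_add_neg] using one_sub_mul_pow_ne_zero hx hq i)
    (summable_norm_qPoch x hq)
  simpa [qPochInf, sub_eq_add_neg] using h

lemma qPochN_succ (x q : ℂ) (N : ℕ) : qPochN x q (N + 1) = qPochN x q N * (1 - x * q ^ N) :=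
  Finset.prod_range_succ _ _

lemma exists_norm_qPochN_le (x : ℂ) {q : ℂ} (hq : ‖q‖ < 1) :
    ∃ C : ℝ, 0 ≤ C ∧ ∀ N, ‖qPochN x q N‖ ≤ C := by
  obtain ⟨C, hC⟩ := (Metric.isBounded_range_of_tendsto _ (tendsto_qPochN x hq)).exists_norm_le
  exact ⟨C, (norm_nonneg _).trans (hC _ ⟨0, rfl⟩), fun N => hC _ ⟨N, rfl⟩⟩

/-- `(x;q)_∞ = (x;q²)_∞ (xq;q²)_∞`. -/
lemma qPochInf_eq_even_mul_odd (x : ℂ) {q : ℂ} (hq : ‖q‖ < 1) :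
    qPochInf x q = qPochInf x (q ^ 2) * qPochInf (x * q) (q ^ 2) := by
  have hq2 : ‖q ^ 2‖ < 1 := by
    rw [norm_pow]; exact pow_lt_one₀ (norm_nonneg _) hq two_ne_zero
  have h := tprod_even_mul_odd (f := fun i : ℕ => 1 - x * q ^ i)
    ((multipliable_qPoch x hq2).congr fun i => by rw [pow_mul])
    ((multipliable_qPoch (x * q) hq2).congr fun i => by ring)
  rw [qPochInf, ← h, qPochInf, qPochInf]
  congr 1
  · exact tprod_congr fun i => by rw [pow_mul]
  · exact tprod_congr fun i => by ring

/-- `(x²;q²)_∞ = (x;q)_∞ (-x;q)_∞`. -/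
lemma qPochInf_sq (x : ℂ) {q : ℂ} (hq : ‖q‖ < 1) :
    qPochInf (x ^ 2) (q ^ 2) = qPochInf x q * qPochInf (-x) q := by
  rw [qPochInf, qPochInf, qPochInf,
    ← (multipliable_qPoch x hq).tprod_mul (multipliable_qPoch (-x) hq)]
  exact tprod_congr fun i => by ring

/-! ### Reciprocals of `(q;q)_m` for integer `m` -/

/-- `1 / (q;q)_m`, with the convention that it vanishes for negative `m`. -/
noncomputable def qFactInv (q : ℂ) (m : ℤ) : ℂ :=
  if m < 0 then 0 else (qPochN q q m.toNat)⁻¹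

lemma qFactInv_natCast (q : ℂ) (m : ℕ) : qFactInv q m = (qPochN q q m)⁻¹ := by
  simp [qFactInv]

lemma qFactInv_of_neg (q : ℂ) {m : ℤ} (hm : m < 0) : qFactInv q m = 0 := by
  simp [qFactInv, hm]

lemma qFactInv_zero (q : ℂ) : qFactInv q 0 = 1 := by
  simp [qFactInv, qPochN]

lemma one_sub_zpow_mul_qFactInv {q : ℂ} (hq : ‖q‖ < 1) (m : ℤ) :
    (1 - q ^ m) * qFactInv q m = qFactInv q (m - 1) := by
  rcases lt_trichotomy m 0 with hm | rfl | hm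
  · rw [qFactInv_of_neg q hm, qFactInv_of_neg q (by omega), mul_zero]
  · rw [qFactInv_of_neg q (by omega : (0 : ℤ) - 1 < 0)]; simp
  · obtain ⟨n, rfl⟩ : ∃ n : ℕ, m = n + 1 := ⟨(m - 1).toNat, by omega⟩
    have h := qPochN_ne_zero hq hq (n + 1)
    have h1 : 1 - q ^ ((n : ℤ) + 1) = 1 - q * q ^ n := by
      rw [← pow_succ']; norm_cast
    rw [add_sub_cancel_right, qFactInv_natCast, show (n : ℤ) + 1 = ((n + 1 : ℕ) : ℤ) by simp,
      qFactInv_natCast]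
    rw [qPochN_succ] at h ⊢
    push_cast
    rw [h1, mul_inv, mul_comm, mul_assoc, inv_mul_cancel₀ (right_ne_zero_of_mul h), mul_one]

lemma tendsto_qFactInv {q : ℂ} (hq : ‖q‖ < 1) :
    Tendsto (qFactInv q) atTop (𝓝 (qPochInf q q)⁻¹) := by
  have hNat : Tendsto Int.toNat atTop atTop :=
    tendsto_atTop_atTop.mpr fun b => ⟨b, fun a ha => by omega⟩
  have h := ((tendsto_qPochN q hq).inv₀ (qPochInf_ne_zero hq hq)).comp hNat
  refine h.congr' ?_
  filter_upwards [eventually_ge_atTop 0] with m hm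
  simp [qFactInv, not_lt.mpr hm]

lemma exists_norm_qFactInv_le {q : ℂ} (hq : ‖q‖ < 1) :
    ∃ C : ℝ, 0 ≤ C ∧ ∀ m, ‖qFactInv q m‖ ≤ C := by
  obtain ⟨C, hC⟩ := (Metric.isBounded_range_of_tendsto _
    ((tendsto_qPochN q hq).inv₀ (qPochInf_ne_zero hq hq))).exists_norm_le
  have hC0 : 0 ≤ C := (norm_nonneg _).trans (hC _ ⟨0, rfl⟩)
  refine ⟨C, hC0, fun m => ?_⟩
  unfold qFactInv
  split_ifs
  · simpa using hC0
  · exact hC _ ⟨m.toNat, rfl⟩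

lemma summable_qFactInv_mul (q : ℂ) (g : ℤ → ℂ) (a b : ℤ) :
    Summable fun n : ℤ => g n * (qFactInv q (a - n) * qFactInv q (b + n)) := by
  refine summable_of_ne_finset_zero (s := Finset.Icc (-b) a) fun n hn => ?_
  rw [Finset.mem_Icc, not_and_or, not_le, not_le] at hn
  rcases hn with hn | hn
  · rw [qFactInv_of_neg q (by omega : b + n < 0)]; simp
  · rw [qFactInv_of_neg q (by omega : a - n < 0)]; simp

/-! ### The Jacobi triple product -/

set_option maxHeartbeats 1000000 in
lemma jacobi_finite_step {p z : ℂ} (hp0 : p ≠ 0) (hp : ‖p‖ < 1) (hz : z ≠ 0) (N : ℤ) :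
    (1 - (p ^ 2) ^ (2 * N + 1)) * (1 - (p ^ 2) ^ (2 * N + 2)) *
      ∑' n : ℤ, ((-1) ^ n * z ^ n * p ^ n ^ 2) *
        (qFactInv (p ^ 2) (N + 1 - n) * qFactInv (p ^ 2) (N + 1 + n)) =
    (1 - z * p ^ (2 * N + 1)) * (1 - z⁻¹ * p ^ (2 * N + 1)) *
      ∑' n : ℤ, ((-1) ^ n * z ^ n * p ^ n ^ 2) *
        (qFactInv (p ^ 2) (N - n) * qFactInv (p ^ 2) (N + n)) := by
  have hp2 : ‖p ^ 2‖ < 1 := by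
    rw [norm_pow]; exact pow_lt_one₀ (norm_nonneg _) hp two_ne_zero
  set R := qFactInv (p ^ 2) with hR
  set t : ℤ → ℂ := fun n => ((-1) ^ n * z ^ n * p ^ n ^ 2) * (R (N - n) * R (N + n)) with ht
  have hts : Summable t := summable_qFactInv_mul _ _ _ _
  have e1 : ∑' n, t (n - 1) = ∑' n, t n := (Equiv.subRight (1 : ℤ)).tsum_eq t
  have e2 : ∑' n, t (n + 1) = ∑' n, t n := (Equiv.addRight (1 : ℤ)).tsum_eq t
  have s1 : Summable fun n => t (n - 1) := (Equiv.subRight (1 : ℤ)).summable_iff.mpr hts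
  have s2 : Summable fun n => t (n + 1) := (Equiv.addRight (1 : ℤ)).summable_iff.mpr hts
  have hz2 : z * z⁻¹ = 1 := mul_inv_cancel₀ hz
  have key : (1 - z * p ^ (2 * N + 1)) * (1 - z⁻¹ * p ^ (2 * N + 1)) * ∑' n, t n =
      (1 + (p ^ (2 * N + 1)) ^ 2) * ∑' n, t n - z * p ^ (2 * N + 1) * ∑' n, t (n - 1)
        - z⁻¹ * p ^ (2 * N + 1) * ∑' n, t (n + 1) := by
    rw [e1, e2]
    linear_combination (p ^ (2 * N + 1)) ^ 2 * (∑' n, t n) * hz2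
  change _ = (1 - z * p ^ (2 * N + 1)) * (1 - z⁻¹ * p ^ (2 * N + 1)) * ∑' n, t n
  rw [key, ← tsum_mul_left, ← tsum_mul_left, ← tsum_mul_left, ← tsum_mul_left,
    ← (hts.mul_left _).tsum_sub (s1.mul_left _),
    ← ((hts.mul_left _).sub (s1.mul_left _)).tsum_sub (s2.mul_left _)]
  refine tsum_congr fun n => ?_
  have r1 := one_sub_zpow_mul_qFactInv hp2 (N + 1 - n)
  have r2 := one_sub_zpow_mul_qFactInv hp2 (N + 1 + n)
  have r3 := one_sub_zpow_mul_qFactInv hp2 (N + n)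
  have r4 := one_sub_zpow_mul_qFactInv hp2 (N - n)
  rw [show N + 1 - n - 1 = N - n by ring, ← hR] at r1
  rw [show N + 1 + n - 1 = N + n by ring, ← hR] at r2
  rw [← hR] at r3 r4
  simp only [ht]
  rw [show N - (n - 1) = N + 1 - n by ring, show N + (n - 1) = N + n - 1 by ring,
    show N - (n + 1) = N - n - 1 by ring, show N + (n + 1) = N + 1 + n by ring,
    ← r3, ← r4, ← r1, ← r2]
  have hm1 : (-1 : ℂ) ≠ 0 := by norm_num
  rw [zpow_sub_one₀ hm1, zpow_add_one₀ hm1, zpow_sub_one₀ hz, zpow_add_one₀ hz]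
  have hb : p ^ n ≠ 0 := zpow_ne_zero _ hp0
  have p1 : p ^ (n - 1) ^ 2 = p ^ n ^ 2 * (p ^ n)⁻¹ ^ 2 * p := by
    rw [← zpow_neg, ← zpow_natCast, ← zpow_mul, ← zpow_add₀ hp0, ← zpow_add_one₀ hp0]
    congr 1; push_cast; ring
  have p2 : p ^ (n + 1) ^ 2 = p ^ n ^ 2 * (p ^ n) ^ 2 * p := by
    rw [← zpow_natCast, ← zpow_mul, ← zpow_add₀ hp0, ← zpow_add_one₀ hp0]
    congr 1; push_cast; ring
  have hpp : ∀ m : ℤ, (p ^ 2) ^ m = (p ^ m) ^ 2 := fun m => by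
    rw [← zpow_natCast, ← zpow_natCast, ← zpow_mul, ← zpow_mul, mul_comm]
  rw [p1, p2]
  simp only [hpp]
  have q1 : p ^ (N + n) = p ^ N * p ^ n := zpow_add₀ hp0 _ _
  have q2 : p ^ (N - n) = p ^ N * (p ^ n)⁻¹ := by rw [zpow_sub₀ hp0, div_eq_mul_inv]
  have q3 : p ^ (N + 1 + n) = p ^ N * p * p ^ n := by rw [zpow_add₀ hp0, zpow_add_one₀ hp0]
  have q4 : p ^ (N + 1 - n) = p ^ N * p * (p ^ n)⁻¹ := by
    rw [zpow_sub₀ hp0, zpow_add_one₀ hp0, div_eq_mul_inv]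
  have q5 : p ^ (2 * N + 1) = (p ^ N) ^ 2 * p := by
    rw [zpow_add_one₀ hp0, mul_comm 2 N, zpow_mul]; rfl
  have q6 : p ^ (2 * N + 2) = (p ^ N) ^ 2 * p ^ 2 := by
    rw [zpow_add₀ hp0, mul_comm 2 N, zpow_mul]; rfl
  rw [q1, q2, q3, q4, q5, q6]
  generalize p ^ n = b at *
  generalize p ^ N = a
  generalize p ^ n ^ 2 = d
  generalize (-1 : ℂ) ^ n = s
  generalize R (N + 1 - n) = x
  generalize R (N + 1 + n) = y
  field_simp
  ring

lemma jacobi_finite {p z : ℂ} (hp0 : p ≠ 0) (hp : ‖p‖ < 1) (hz : z ≠ 0) (N : ℕ) :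
    ∑' n : ℤ, ((-1) ^ n * z ^ n * p ^ n ^ 2) *
        (qFactInv (p ^ 2) (N - n) * qFactInv (p ^ 2) (N + n)) =
      qPochN (z * p) (p ^ 2) N * qPochN (z⁻¹ * p) (p ^ 2) N * qFactInv (p ^ 2) (2 * N) := by
  have hp2 : ‖p ^ 2‖ < 1 := by
    rw [norm_pow]; exact pow_lt_one₀ (norm_nonneg _) hp two_ne_zero
  induction N with
  | zero =>
    rw [tsum_eq_single 0]
    · simp [qFactInv_zero, qPochN]
    · intro n hn
      rcases lt_or_gt_of_ne hn with h | h
      · rw [qFactInv_of_neg _ (by simpa using h : ((0 : ℕ) : ℤ) + n < 0)]; simp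
      · rw [qFactInv_of_neg _ (by simpa using h : ((0 : ℕ) : ℤ) - n < 0)]; simp
  | succ N ih =>
    have h := jacobi_finite_step hp0 hp hz N
    rw [ih] at h
    have r1 := one_sub_zpow_mul_qFactInv hp2 (2 * N + 1)
    have r2 := one_sub_zpow_mul_qFactInv hp2 (2 * N + 2)
    rw [show (2 * N + 2 - 1 : ℤ) = 2 * N + 1 by ring] at r2
    rw [show (2 * N + 1 - 1 : ℤ) = 2 * N by ring] at r1
    have hne : ∀ m : ℕ, (1 - (p ^ 2) ^ ((m : ℤ) + 1)) ≠ 0 := fun m => by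
      have := one_sub_mul_pow_ne_zero hp2 hp2 m
      rw [← pow_succ'] at this
      exact_mod_cast this
    have n1 := hne (2 * N)
    have n2 := hne (2 * N + 1)
    push_cast at n1 n2 ⊢
    rw [show (2 * N + 1 + 1 : ℤ) = 2 * N + 2 by ring] at n2
    refine mul_left_cancel₀ (mul_ne_zero n1 n2) ?_
    rw [h, ← r1, ← r2, qPochN_succ, qPochN_succ, show (2 * (N + 1) : ℤ) = 2 * N + 2 by ring]
    have hz1 : z * p * (p ^ 2) ^ N = z * p ^ (2 * (N : ℤ) + 1) := by
      rw [zpow_add_one₀ hp0, zpow_mul, zpow_natCast]; norm_cast; ring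
    have hz2 : z⁻¹ * p * (p ^ 2) ^ N = z⁻¹ * p ^ (2 * (N : ℤ) + 1) := by
      rw [zpow_add_one₀ hp0, zpow_mul, zpow_natCast]; norm_cast; ring
    rw [hz1, hz2]
    ring

/-- The Jacobi triple product identity. -/
theorem jacobi_triple_product {p z : ℂ} (hp0 : p ≠ 0) (hp : ‖p‖ < 1) (hz : z ≠ 0)
    (hs : Summable fun n : ℤ => (-1) ^ n * z ^ n * p ^ n ^ 2) :
    ∑' n : ℤ, (-1) ^ n * z ^ n * p ^ n ^ 2 =
      qPochInf (z * p) (p ^ 2) * qPochInf (z⁻¹ * p) (p ^ 2) * qPochInf (p ^ 2) (p ^ 2) := by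
  have hp2 : ‖p ^ 2‖ < 1 := by
    rw [norm_pow]; exact pow_lt_one₀ (norm_nonneg _) hp two_ne_zero
  obtain ⟨C, hC0, hC⟩ := exists_norm_qFactInv_le hp2
  have hK := qPochInf_ne_zero hp2 hp2
  set K := qPochInf (p ^ 2) (p ^ 2)
  have lim1 : Tendsto (fun N : ℕ => ∑' n : ℤ, ((-1) ^ n * z ^ n * p ^ n ^ 2) *
        (qFactInv (p ^ 2) (N - n) * qFactInv (p ^ 2) (N + n))) atTop
      (𝓝 (∑' n : ℤ, ((-1) ^ n * z ^ n * p ^ n ^ 2) * (K⁻¹ * K⁻¹))) := by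
    refine tendsto_tsum_of_dominated_convergence
      (bound := fun n => ‖(-1) ^ n * z ^ n * p ^ n ^ 2‖ * (C * C)) (hs.norm.mul_right _) ?_ ?_
    · intro n
      refine Tendsto.const_mul _ (Tendsto.mul ?_ ?_)
      · exact (tendsto_qFactInv hp2).comp
          (tendsto_atTop_add_const_right _ (-n) tendsto_natCast_atTop_atTop)
      · exact (tendsto_qFactInv hp2).comp
          (tendsto_atTop_add_const_right _ n tendsto_natCast_atTop_atTop)
    · refine Eventually.of_forall fun N n => ?_
      rw [norm_mul, norm_mul (qFactInv _ _)]
      gcongr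
      · exact hC _
      · exact hC _
  have lim2 : Tendsto (fun N : ℕ => qPochN (z * p) (p ^ 2) N * qPochN (z⁻¹ * p) (p ^ 2) N *
      qFactInv (p ^ 2) (2 * N)) atTop
      (𝓝 (qPochInf (z * p) (p ^ 2) * qPochInf (z⁻¹ * p) (p ^ 2) * K⁻¹)) := by
    refine ((tendsto_qPochN _ hp2).mul (tendsto_qPochN _ hp2)).mul
      ((tendsto_qFactInv hp2).comp ?_)
    exact tendsto_natCast_atTop_atTop.const_mul_atTop' (by norm_num)
  have h := tendsto_nhds_unique lim1 (lim2.congr fun N => (jacobi_finite hp0 hp hz N).symm)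
  rw [tsum_mul_right] at h
  field_simp at h
  rw [h, div_eq_inv_mul]
  ring

lemma norm_sq_lt_one {q : ℂ} (hq : ‖q‖ < 1) : ‖q ^ 2‖ < 1 := by
  rw [norm_pow]; exact pow_lt_one₀ (norm_nonneg _) hq two_ne_zero

lemma sq_zpow (q : ℂ) (m : ℤ) : (q ^ 2) ^ m = q ^ (2 * m) := by
  rw [zpow_mul]; norm_cast

/-! ### The Bailey-type summation over the number of peaks -/

/-- The factor `q^{N²} (-q;q²)_N`. -/
noncomputable def peakFactor (q : ℂ) (N : ℕ) : ℂ := q ^ (N ^ 2) * qPochN (-q) (q ^ 2) N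

lemma peakFactor_zero (q : ℂ) : peakFactor q 0 = 1 := by simp [peakFactor, qPochN]

lemma peakFactor_succ (q : ℂ) (N : ℕ) :
    peakFactor q (N + 1) = (q ^ (4 * N + 2) + q ^ (2 * N + 1)) * peakFactor q N := by
  rw [peakFactor, peakFactor, qPochN_succ]; ring

lemma summable_norm_peakFactor {q : ℂ} (hq : ‖q‖ < 1) :
    Summable fun N => ‖peakFactor q N‖ := by
  obtain ⟨C, hC0, hC⟩ := exists_norm_qPochN_le (-q) (norm_sq_lt_one hq)
  refine Summable.of_nonneg_of_le (fun _ => norm_nonneg _) (fun N => ?_)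
    ((summable_geometric_of_lt_one (norm_nonneg q) hq).mul_right C)
  rw [peakFactor, norm_mul, norm_pow]
  refine mul_le_mul (pow_le_pow_of_le_one (norm_nonneg _) hq.le ?_) (hC N) (norm_nonneg _)
    (by positivity)
  nlinarith [sq_nonneg ((N : ℤ) - 1), Nat.le_self_pow two_ne_zero N]

lemma summable_norm_peakFactor_mul {q : ℂ} (hq : ‖q‖ < 1) (a b : ℤ) :
    Summable fun N : ℕ =>
      peakFactor q N * (qFactInv (q ^ 2) (N - a) * qFactInv (q ^ 2) (N + b)) := by
  obtain ⟨C, hC0, hC⟩ := exists_norm_qFactInv_le (norm_sq_lt_one hq)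
  refine Summable.of_norm_bounded ((summable_norm_peakFactor hq).mul_right (C * C)) fun N => ?_
  rw [norm_mul, norm_mul (qFactInv _ _)]
  gcongr
  · exact hC _
  · exact hC _

/-- `∑_N q^{N²} (-q;q²)_N / ((q²;q²)_{N-n} (q²;q²)_{N+n})`. -/
noncomputable def baileySum (q : ℂ) (n : ℤ) : ℂ :=
  ∑' N : ℕ, peakFactor q N * (qFactInv (q ^ 2) (N - n) * qFactInv (q ^ 2) (N + n))

lemma baileySum_neg (q : ℂ) (n : ℤ) : baileySum q (-n) = baileySum q n :=
  tsum_congr fun N => by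
    rw [sub_neg_eq_add, mul_comm (qFactInv _ _), ← sub_eq_add_neg]

lemma baileySum_add_one {q : ℂ} (hq0 : q ≠ 0) (hq : ‖q‖ < 1) (n : ℤ) :
    baileySum q (n + 1) = q ^ (2 * n + 1) * baileySum q n := by
  have hq2 := norm_sq_lt_one hq
  set R := qFactInv (q ^ 2) with hR
  set V : ℕ → ℂ := fun N => peakFactor q N * (R (N - (n + 1)) * R (N + n)) with hV
  have hVs : Summable V := summable_norm_peakFactor_mul hq _ _
  have hV0 : V 0 = 0 := by
    simp only [hV]
    rcases lt_or_ge n 0 with h | h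
    · rw [hR, qFactInv_of_neg _ (by simpa using h : ((0 : ℕ) : ℤ) + n < 0)]; simp
    · rw [hR, qFactInv_of_neg _ (by simp; omega : ((0 : ℕ) : ℤ) - (n + 1) < 0)]; simp
  have hV1 : ∑' N, V (N + 1) = ∑' N, V N := by
    rw [hVs.tsum_eq_zero_add, hV0, zero_add]
  have hVs' : Summable fun N => V (N + 1) := (summable_nat_add_iff 1).mpr hVs
  have s1 := summable_norm_peakFactor_mul hq (n + 1) (n + 1)
  have s2 := summable_norm_peakFactor_mul hq n n
  rw [← sub_eq_zero, baileySum, baileySum, ← tsum_mul_left, ← s1.tsum_sub (s2.mul_left _)]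
  have h0 : ∑' N, (q ^ (2 * n + 1) - 1) * (V (N + 1) - V N) = 0 := by
    rw [tsum_mul_left, hVs'.tsum_sub hVs, hV1, sub_self, mul_zero]
  rw [← h0]
  refine tsum_congr fun N => ?_
  have r1 := one_sub_zpow_mul_qFactInv hq2 (N - n)
  have r2 := one_sub_zpow_mul_qFactInv hq2 (N + n + 1)
  rw [show (N + n + 1 - 1 : ℤ) = N + n by ring] at r2
  rw [← hR] at r1 r2
  simp only [hV, peakFactor_succ]
  push_cast
  rw [← hR, show (N + 1 - (n + 1) : ℤ) = N - n by ring, show (N + 1 + n : ℤ) = N + n + 1 by ring,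
    show (N - (n + 1) : ℤ) = N - n - 1 by ring, show (N + (n + 1) : ℤ) = N + n + 1 by ring,
    ← r1, ← r2]
  have hb : q ^ n ≠ 0 := zpow_ne_zero _ hq0
  have q1 : (q ^ 2) ^ ((N : ℤ) - n) = (q ^ N) ^ 2 * (q ^ n)⁻¹ ^ 2 := by
    rw [zpow_sub₀ (pow_ne_zero 2 hq0), zpow_natCast, sq_zpow, mul_comm 2 n, zpow_mul]
    rw [div_eq_mul_inv, ← pow_mul, ← pow_mul, mul_comm]
    norm_cast
    rw [inv_pow]
    ring
  have q2 : (q ^ 2) ^ ((N : ℤ) + n + 1) = (q ^ N) ^ 2 * (q ^ n) ^ 2 * q ^ 2 := by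
    rw [zpow_add_one₀ (pow_ne_zero 2 hq0), zpow_add₀ (pow_ne_zero 2 hq0), zpow_natCast, sq_zpow,
      mul_comm 2 n, zpow_mul, ← pow_mul, ← pow_mul, mul_comm N 2]
    norm_cast
  have q3 : q ^ (2 * n + 1) = (q ^ n) ^ 2 * q := by
    rw [zpow_add_one₀ hq0, mul_comm 2 n, zpow_mul]; norm_cast
  have q4 : q ^ (4 * N + 2) = (q ^ N) ^ 4 * q ^ 2 := by ring
  have q5 : q ^ (2 * N + 1) = (q ^ N) ^ 2 * q := by ring
  rw [q1, q2, q3, q4, q5]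
  generalize q ^ n = b at *
  generalize q ^ N = a
  generalize R (N - n) = x
  generalize R (N + n + 1) = y
  field_simp
  ring

lemma baileySum_natCast {q : ℂ} (hq0 : q ≠ 0) (hq : ‖q‖ < 1) (n : ℕ) :
    baileySum q n = q ^ (n ^ 2) * baileySum q 0 := by
  induction n with
  | zero => simp
  | succ n ih =>
    push_cast
    rw [baileySum_add_one hq0 hq, ih]
    have : q ^ (2 * (n : ℤ) + 1) = q ^ (2 * n + 1) := by norm_cast
    rw [this]
    ring

lemma baileySum_eq_sq {q : ℂ} (hq0 : q ≠ 0) (hq : ‖q‖ < 1) (n : ℤ) :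
    baileySum q n = q ^ (n ^ 2) * baileySum q 0 := by
  obtain ⟨m, rfl | rfl⟩ := n.eq_nat_or_neg
  · rw [baileySum_natCast hq0 hq]; norm_cast
  · rw [baileySum_neg, baileySum_natCast hq0 hq, neg_sq]; norm_cast

lemma baileySum_zero {q : ℂ} (hq0 : q ≠ 0) (hq : ‖q‖ < 1) :
    baileySum q 0 = qPochInf (-q) (q ^ 2) * (qPochInf (q ^ 2) (q ^ 2))⁻¹ := by
  have hq2 := norm_sq_lt_one hq
  obtain ⟨C, hC0, hC⟩ := exists_norm_qFactInv_le hq2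
  obtain ⟨D, hD0, hD⟩ := exists_norm_qPochN_le (-q) hq2
  have shift (n : ℕ) : baileySum q 0 = ∑' m : ℕ, q ^ (m ^ 2) * (q ^ (2 * m)) ^ n *
      (qPochN (-q) (q ^ 2) (n + m) * (qFactInv (q ^ 2) m * qFactInv (q ^ 2) (2 * n + m))) := by
    have h := baileySum_natCast hq0 hq n
    rw [baileySum, ← (summable_norm_peakFactor_mul hq n n).sum_add_tsum_nat_add n,
      Finset.sum_eq_zero, zero_add] at h
    · refine mul_left_cancel₀ (pow_ne_zero (n ^ 2) hq0) ?_
      rw [← h, ← tsum_mul_left]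
      refine tsum_congr fun m => ?_
      push_cast
      rw [show (m + n - n : ℤ) = m by ring, show (m + n + n : ℤ) = 2 * n + m by ring, peakFactor,
        add_comm n m]
      ring
    · intro N hN
      rw [qFactInv_of_neg _ (by have := Finset.mem_range.mp hN; omega : (N : ℤ) - n < 0)]
      simp
  have hpow : ∀ m : ℕ, m ≠ 0 → ‖q ^ (2 * m)‖ < 1 := fun m hm => by
    rw [norm_pow]; exact pow_lt_one₀ (norm_nonneg _) hq (by omega)
  have lim : Tendsto (fun n : ℕ => ∑' m : ℕ, q ^ (m ^ 2) * (q ^ (2 * m)) ^ n *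
      (qPochN (-q) (q ^ 2) (n + m) * (qFactInv (q ^ 2) m * qFactInv (q ^ 2) (2 * n + m)))) atTop
      (𝓝 (∑' m : ℕ, if m = 0 then qPochInf (-q) (q ^ 2) * (qPochInf (q ^ 2) (q ^ 2))⁻¹
        else 0)) := by
    have l1 (m : ℕ) : Tendsto (fun n : ℕ => qPochN (-q) (q ^ 2) (n + m)) atTop
        (𝓝 (qPochInf (-q) (q ^ 2))) :=
      (tendsto_qPochN (-q) hq2).comp (tendsto_add_atTop_nat m)
    have l2 (m : ℕ) : Tendsto (fun n : ℕ => qFactInv (q ^ 2) (2 * n + m)) atTop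
        (𝓝 (qPochInf (q ^ 2) (q ^ 2))⁻¹) :=
      (tendsto_qFactInv hq2).comp (tendsto_atTop_add_const_right _ _
        (tendsto_natCast_atTop_atTop.const_mul_atTop' (by norm_num)))
    refine tendsto_tsum_of_dominated_convergence
      (bound := fun m => ‖q‖ ^ m * (D * (C * C)))
      ((summable_geometric_of_lt_one (norm_nonneg q) hq).mul_right _) ?_ ?_
    · intro m
      rcases eq_or_ne m 0 with rfl | hm
      · simpa [qFactInv_zero] using (l1 0).mul (l2 0)
      · rw [if_neg hm]
        have := ((tendsto_pow_atTop_nhds_zero_of_norm_lt_one (hpow m hm)).const_mul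
          (q ^ m ^ 2)).mul ((l1 m).mul ((l2 m).const_mul (qFactInv (q ^ 2) m)))
        simpa using this
    · refine Eventually.of_forall fun n m => ?_
      rw [norm_mul, norm_mul, norm_mul (qPochN _ _ _), norm_mul (qFactInv _ _)]
      have e1 : ‖q ^ m ^ 2‖ * ‖(q ^ (2 * m)) ^ n‖ ≤ ‖q‖ ^ m := by
        rw [← norm_mul, ← pow_mul, ← pow_add, norm_pow]
        refine pow_le_pow_of_le_one (norm_nonneg _) hq.le ?_
        exact (Nat.le_self_pow two_ne_zero m).trans (Nat.le_add_right _ _)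
      gcongr
      · exact hD _
      · exact hC _
      · exact hC _
  have h := tendsto_nhds_unique (tendsto_const_nhds.congr shift) lim
  rw [h, tsum_ite_eq]

/-! ### Closed forms for the generating functions with a fixed number of peaks -/

/-- `∑_n (-1)^n q^{(2k-1)n² + (2h+1)n} / ((q²;q²)_{A-n} (q²;q²)_{B+n})`. -/
noncomputable def thetaSum (k : ℕ) (q : ℂ) (h A B : ℤ) : ℂ :=
  ∑' n : ℤ, ((-1) ^ n * q ^ ((2 * k - 1) * n ^ 2 + (2 * h + 1) * n)) *
    (qFactInv (q ^ 2) (A - n) * qFactInv (q ^ 2) (B + n))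

lemma thetaSum_sub_left {k : ℕ} {q : ℂ} (hq0 : q ≠ 0) (hq : ‖q‖ < 1) (h A B : ℤ) :
    thetaSum k q h A B - q ^ (2 * A) * thetaSum k q (h - 1) A B = thetaSum k q h (A - 1) B := by
  rw [thetaSum, thetaSum, ← tsum_mul_left, ← (summable_qFactInv_mul _ _ _ _).tsum_sub
    ((summable_qFactInv_mul _ _ _ _).mul_left _)]
  refine tsum_congr fun n => ?_
  rw [show A - 1 - n = A - n - 1 by ring, ← one_sub_zpow_mul_qFactInv (norm_sq_lt_one hq) (A - n)]
  have e : q ^ (2 * A) * q ^ ((2 * k - 1) * n ^ 2 + (2 * (h - 1) + 1) * n) =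
      q ^ ((2 * k - 1) * n ^ 2 + (2 * h + 1) * n) * (q ^ 2) ^ (A - n) := by
    rw [sq_zpow, ← zpow_add₀ hq0, ← zpow_add₀ hq0]; congr 1; ring
  linear_combination (-(-1) ^ n * (qFactInv (q ^ 2) (A - n) * qFactInv (q ^ 2) (B + n))) * e

lemma thetaSum_sub_right {k : ℕ} {q : ℂ} (hq0 : q ≠ 0) (hq : ‖q‖ < 1) (h A B : ℤ) :
    thetaSum k q h A B - q ^ (2 * B) * thetaSum k q (h + 1) A B = thetaSum k q h A (B - 1) := by
  rw [thetaSum, thetaSum, ← tsum_mul_left, ← (summable_qFactInv_mul _ _ _ _).tsum_sub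
    ((summable_qFactInv_mul _ _ _ _).mul_left _)]
  refine tsum_congr fun n => ?_
  rw [show B - 1 + n = B + n - 1 by ring, ← one_sub_zpow_mul_qFactInv (norm_sq_lt_one hq) (B + n)]
  have e : q ^ (2 * B) * q ^ ((2 * k - 1) * n ^ 2 + (2 * (h + 1) + 1) * n) =
      q ^ ((2 * k - 1) * n ^ 2 + (2 * h + 1) * n) * (q ^ 2) ^ (B + n) := by
    rw [sq_zpow, ← zpow_add₀ hq0, ← zpow_add₀ hq0]; congr 1; ring
  linear_combination (-(-1) ^ n * (qFactInv (q ^ 2) (A - n) * qFactInv (q ^ 2) (B + n))) * e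

lemma thetaSum_neg_one (k : ℕ) (q : ℂ) (A : ℤ) :
    thetaSum k q (-1) A A = thetaSum k q 0 A A := by
  rw [thetaSum, ← (Equiv.neg ℤ).tsum_eq]
  refine tsum_congr fun n => ?_
  simp only [Equiv.neg_apply]
  rw [mul_comm (qFactInv _ _), sub_neg_eq_add, ← sub_eq_add_neg]
  congr 2
  · rw [zpow_neg, ← inv_zpow]; norm_num
  · congr 1; ring

lemma thetaSum_top (k : ℕ) (q : ℂ) (A : ℤ) : thetaSum k q (k - 1) (A - 1) A = 0 := by
  have h : thetaSum k q (k - 1) (A - 1) A = -thetaSum k q (k - 1) (A - 1) A := by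
    conv_lhs => rw [thetaSum, ← (Equiv.subLeft (-1 : ℤ)).tsum_eq]
    rw [thetaSum, ← tsum_neg]
    refine tsum_congr fun n => ?_
    simp only [Equiv.subLeft_apply]
    rw [mul_comm (qFactInv _ _), show A - 1 - (-1 - n) = A + n by ring,
      show A + (-1 - n) = A - 1 - n by ring, ← neg_mul, ← neg_mul]
    congr 2
    · rw [show -1 - n = -(n + 1) by ring, zpow_neg, ← inv_zpow,
        zpow_add_one₀ (by norm_num : (-1 : ℂ)⁻¹ ≠ 0)]
      norm_num
    · congr 1; ring
  exact self_eq_neg.mp h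

/-- Closed form of the generating function of paths starting at height `h` with `N` peaks. -/
noncomputable def pathGF (k : ℕ) (q : ℂ) (h : ℤ) (N : ℕ) : ℂ :=
  peakFactor q N * thetaSum k q h N N

/-- Closed form of the generating function of paths starting at height `h` with a North-East
step and having `N` peaks. -/
noncomputable def risingGF (k : ℕ) (q : ℂ) (h : ℤ) (N : ℕ) : ℂ :=
  peakFactor q N * thetaSum k q h (N - 1) N

lemma pathGF_eq {k : ℕ} {q : ℂ} (hq0 : q ≠ 0) (hq : ‖q‖ < 1) (h : ℤ) (N : ℕ) :
    pathGF k q h N = q ^ (2 * N) * pathGF k q (h - 1) N + risingGF k q h N := by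
  have e := thetaSum_sub_left (k := k) hq0 hq h N N
  have e2 : q ^ (2 * (N : ℤ)) = q ^ (2 * N) := by norm_cast
  rw [e2] at e
  rw [pathGF, pathGF, risingGF]
  linear_combination peakFactor q N * e

lemma pathGF_zero_eq {k : ℕ} {q : ℂ} (hq0 : q ≠ 0) (hq : ‖q‖ < 1) (N : ℕ) :
    pathGF k q 0 N = q ^ (2 * N) * pathGF k q 0 N + risingGF k q 0 N := by
  have e := pathGF_eq (k := k) hq0 hq 0 N
  rw [pathGF, pathGF, zero_sub, thetaSum_neg_one] at e
  exact e

lemma risingGF_top (k : ℕ) (q : ℂ) (N : ℕ) : risingGF k q (k - 1) N = 0 := by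
  rw [risingGF, thetaSum_top, mul_zero]

lemma risingGF_succ {k : ℕ} {q : ℂ} (hq0 : q ≠ 0) (hq : ‖q‖ < 1) (h : ℤ) (N : ℕ) :
    risingGF k q h (N + 1) = q ^ (2 * (N + 1)) * risingGF k q (h + 1) (N + 1) +
      (q ^ (4 * N + 2) + q ^ (2 * N + 1)) * pathGF k q h N := by
  have e := thetaSum_sub_right (k := k) hq0 hq h N (N + 1)
  have e2 : q ^ (2 * ((N : ℤ) + 1)) = q ^ (2 * (N + 1)) := by norm_cast
  rw [e2, add_sub_cancel_right] at e
  rw [pathGF, risingGF, risingGF, peakFactor_succ]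
  push_cast
  rw [add_sub_cancel_right]
  linear_combination (q ^ (4 * N + 2) + q ^ (2 * N + 1)) * peakFactor q N * e

lemma pathGF_zero_right (k : ℕ) (q : ℂ) (h : ℤ) : pathGF k q h 0 = 1 := by
  rw [pathGF, thetaSum, tsum_eq_single 0]
  · simp [qFactInv_zero, peakFactor_zero]
  · intro n hn
    rcases lt_or_gt_of_ne hn with h | h
    · rw [qFactInv_of_neg _ (by simpa using h : ((0 : ℕ) : ℤ) + n < 0)]; simp
    · rw [qFactInv_of_neg _ (by simpa using h : ((0 : ℕ) : ℤ) - n < 0)]; simp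

lemma risingGF_zero_right (k : ℕ) (q : ℂ) (h : ℤ) : risingGF k q h 0 = 0 := by
  rw [risingGF, thetaSum]
  have : ∀ n : ℤ, ((-1) ^ n * q ^ ((2 * k - 1) * n ^ 2 + (2 * h + 1) * n)) *
      (qFactInv (q ^ 2) (((0 : ℕ) : ℤ) - 1 - n) * qFactInv (q ^ 2) (((0 : ℕ) : ℤ) + n)) = 0 := by
    intro n
    rcases lt_or_ge n 0 with h | h
    · rw [qFactInv_of_neg _ (by simpa using h : ((0 : ℕ) : ℤ) + n < 0)]; simp
    · rw [qFactInv_of_neg _ (by simp; omega : ((0 : ℕ) : ℤ) - 1 - n < 0)]; simp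
  simp only [this, tsum_zero, mul_zero]

/-! ### Summation over the number of peaks -/

lemma summable_pow_natAbs {r : ℝ} (h0 : 0 ≤ r) (h1 : r < 1) :
    Summable fun n : ℤ => r ^ n.natAbs := by
  have h := summable_geometric_of_lt_one h0 h1
  exact Summable.of_nat_of_neg (by simpa using h) (by simpa using h)

lemma summable_theta {q : ℂ} (hq0 : q ≠ 0) (hq : ‖q‖ < 1) {a b : ℤ} (hb0 : 0 ≤ b)
    (hba : b ≤ a) (ha : 1 ≤ a) :
    Summable fun n : ℤ => (-1 : ℂ) ^ n * q ^ (a * n ^ 2 + b * n) := by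
  have hr : 0 < ‖q‖ := norm_pos_iff.mpr hq0
  refine Summable.of_norm_bounded
    ((summable_pow_natAbs (norm_nonneg q) hq).mul_left ‖q‖⁻¹) fun n => ?_
  rw [norm_mul, norm_zpow, norm_neg, norm_one, one_zpow, one_mul, norm_zpow, ← zpow_natCast,
    ← zpow_neg_one, ← zpow_add₀ hr.ne']
  refine zpow_le_zpow_right_of_le_one₀ hr hq.le ?_
  rw [Int.natCast_natAbs]
  rcases lt_or_ge n 0 with hn | hn
  · rw [abs_of_neg hn]
    nlinarith [mul_nonneg (by omega : 0 ≤ -n) (sub_nonneg.mpr hba),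
      mul_nonneg (mul_nonneg (by omega : 0 ≤ -n) (by omega : 0 ≤ -n - 1)) (sub_nonneg.mpr ha),
      mul_nonneg (by omega : 0 ≤ -n - 1) (by omega : 0 ≤ -n - 1)]
  · rw [abs_of_nonneg hn]
    nlinarith [mul_nonneg hb0 hn, mul_nonneg (sub_nonneg.mpr ha) (sq_nonneg n), sq_nonneg (n - 1)]

/-- Summing the closed forms over the number of peaks gives a theta series. -/
lemma hasSum_pathGF {k : ℕ} {q : ℂ} (hq0 : q ≠ 0) (hq : ‖q‖ < 1) {h : ℤ} (h0 : 0 ≤ h)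
    (hk : h < k) :
    HasSum (pathGF k q h) (qPochInf (-q) (q ^ 2) * (qPochInf (q ^ 2) (q ^ 2))⁻¹ *
      ∑' n : ℤ, (-1) ^ n * q ^ (2 * k * n ^ 2 + (2 * h + 1) * n)) := by
  obtain ⟨C, hC0, hC⟩ := exists_norm_qFactInv_le (norm_sq_lt_one hq)
  set g : ℤ → ℂ := fun n => (-1) ^ n * q ^ ((2 * k - 1) * n ^ 2 + (2 * h + 1) * n) with hg
  have hgs : Summable g := summable_theta hq0 hq (by omega) (by omega) (by omega)
  set F : ℕ × ℤ → ℂ := fun p => peakFactor q p.1 *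
    (g p.2 * (qFactInv (q ^ 2) (p.1 - p.2) * qFactInv (q ^ 2) (p.1 + p.2))) with hF
  have hFs : Summable F := by
    have hb := ((summable_norm_peakFactor hq).mul_of_nonneg hgs.norm (fun _ => norm_nonneg _)
      (fun _ => norm_nonneg _)).mul_right (C * C)
    refine Summable.of_norm_bounded hb fun p => ?_
    rw [hF, norm_mul, norm_mul (g _), norm_mul (qFactInv _ _), mul_assoc]
    gcongr
    · exact hC _
    · exact hC _
  have h1 : HasSum (pathGF k q h) (∑' p, F p) := by
    refine hFs.hasSum.prod_fiberwise fun N => ?_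
    rw [pathGF, thetaSum]
    exact (summable_qFactInv_mul (q ^ 2) g N N).hasSum.mul_left (peakFactor q N)
  convert h1 using 1
  have hFs' : Summable fun p : ℤ × ℕ => F (Equiv.prodComm ℤ ℕ p) :=
    (Equiv.prodComm ℤ ℕ).summable_iff.mpr hFs
  rw [← (Equiv.prodComm ℤ ℕ).tsum_eq F, hFs'.tsum_prod, ← baileySum_zero hq0 hq,
    ← tsum_mul_left]
  refine tsum_congr fun n => ?_
  have e : ∀ N : ℕ, F (Equiv.prodComm ℤ ℕ (n, N)) = g n * (peakFactor q N *
      (qFactInv (q ^ 2) (N - n) * qFactInv (q ^ 2) (N + n))) := fun N => by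
    simp only [hF, Equiv.prodComm_apply, Prod.swap_prod_mk]; ring
  rw [tsum_congr e, tsum_mul_left]
  change _ = g n * baileySum q n
  rw [baileySum_eq_sq hq0 hq n, hg]
  have e2 : q ^ (2 * (k : ℤ) * n ^ 2 + (2 * h + 1) * n) =
      q ^ ((2 * k - 1) * n ^ 2 + (2 * h + 1) * n) * q ^ n ^ 2 := by
    rw [← zpow_add₀ hq0]; congr 1; ring
  rw [e2]; ring

/-! ### Recursive description of special paths -/

/-- Special paths of height less than `k` starting at height `h`; the first step may be a South
step when `afterNE` is `true`. -/
def SpecialFrom (k : ℕ) (afterNE : Bool) (h : ℤ) (l : List PStep) : Prop :=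
  (∀ m : ℕ, 0 ≤ h + ((l.take m).map stepDy).sum ∧ h + ((l.take m).map stepDy).sum < k) ∧
  (∀ m : ℕ, l[m]? = some PStep.S →
    (m = 0 ∧ afterNE = true) ∨ ∃ m', m = m' + 1 ∧ l[m']? = some PStep.NE) ∧
  (∀ m : ℕ, l[m]? = some PStep.E → h + ((l.take m).map stepDy).sum = 0) ∧
  h + (l.map stepDy).sum = 0 ∧
  (l = [] ∨ l.getLast? = some PStep.SE ∨ l.getLast? = some PStep.S)

lemma specialPath_iff {k i : ℕ} (hik : i ≤ k) (l : List PStep) :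
    SpecialPath k i l ↔ SpecialFrom k false (k - i) l := by
  simp only [SpecialPath, ValidPath, SpecialFrom, pathHeight, Nat.cast_sub hik, forall_and]
  simp
  tauto

lemma SpecialFrom.nonneg {k : ℕ} {b : Bool} {h : ℤ} {l : List PStep}
    (H : SpecialFrom k b h l) : 0 ≤ h := by simpa using (H.1 0).1

lemma SpecialFrom.lt {k : ℕ} {b : Bool} {h : ℤ} {l : List PStep}
    (H : SpecialFrom k b h l) : h < k := by simpa using (H.1 0).2

lemma specialFrom_nil {k : ℕ} {b : Bool} {h : ℤ} :
    SpecialFrom k b h [] ↔ h = 0 ∧ 0 < k := by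
  constructor
  · intro H
    obtain rfl : h = 0 := by simpa using H.2.2.2.1
    exact ⟨rfl, by exact_mod_cast H.lt⟩
  · rintro ⟨rfl, hk⟩
    simp [SpecialFrom, hk]

lemma forall_nat_iff {p : ℕ → Prop} : (∀ m, p m) ↔ p 0 ∧ ∀ m, p (m + 1) :=
  ⟨fun H => ⟨H 0, fun m => H (m + 1)⟩, fun H m => by cases m; exacts [H.1, H.2 _]⟩

lemma specialFrom_cons {k : ℕ} {b : Bool} {h : ℤ} {s : PStep} {l : List PStep} :
    SpecialFrom k b h (s :: l) ↔ (0 ≤ h ∧ h < k) ∧ (s = .S → b = true) ∧ (s = .E → h = 0) ∧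
      (l = [] → s = .SE ∨ s = .S) ∧
      SpecialFrom k (decide (s = .NE)) (h + stepDy s) l := by
  have hS : (∀ m : ℕ, (s :: l)[m]? = some PStep.S →
      (m = 0 ∧ b = true) ∨ ∃ m', m = m' + 1 ∧ (s :: l)[m']? = some PStep.NE) ↔
      (s = .S → b = true) ∧ (∀ m : ℕ, l[m]? = some PStep.S →
      (m = 0 ∧ decide (s = .NE) = true) ∨ ∃ m', m = m' + 1 ∧ l[m']? = some PStep.NE) := by
    rw [forall_nat_iff]
    refine and_congr (by simp) (forall_congr' fun m => imp_congr (by simp) ?_)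
    cases m with
    | zero => simp
    | succ m => simp
  have hE : (∀ m : ℕ, (s :: l)[m]? = some PStep.E →
      h + (((s :: l).take m).map stepDy).sum = 0) ↔
      (s = .E → h = 0) ∧ (∀ m : ℕ, l[m]? = some PStep.E →
        h + stepDy s + ((l.take m).map stepDy).sum = 0) := by
    rw [forall_nat_iff]
    simp [add_assoc]
  have hH : (∀ m : ℕ, 0 ≤ h + (((s :: l).take m).map stepDy).sum ∧
      h + (((s :: l).take m).map stepDy).sum < k) ↔
      (0 ≤ h ∧ h < k) ∧ (∀ m : ℕ, 0 ≤ h + stepDy s + ((l.take m).map stepDy).sum ∧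
        h + stepDy s + ((l.take m).map stepDy).sum < k) := by
    rw [forall_nat_iff]
    simp [add_assoc]
  have hL : (s :: l = [] ∨ (s :: l).getLast? = some PStep.SE ∨
      (s :: l).getLast? = some PStep.S) ↔ (l = [] → s = .SE ∨ s = .S) ∧
      (l = [] ∨ l.getLast? = some PStep.SE ∨ l.getLast? = some PStep.S) := by
    cases l with
    | nil => simp
    | cons t l => simp [List.getLast?_cons_cons]
  rw [SpecialFrom, hS, hE, hH, hL, SpecialFrom, List.map_cons, List.sum_cons, ← add_assoc]
  exact ⟨fun ⟨h1, h2, h3, h4, h5⟩ => ⟨h1.1, h2.1, h3.1, h5.1, h1.2, h2.2, h3.2, h4, h5.2⟩,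
    fun ⟨h1, h2, h3, h5, g1, g2, g3, h4, g5⟩ => ⟨⟨h1, g1⟩, ⟨h2, g2⟩, ⟨h3, g3⟩, h4, ⟨h5, g5⟩⟩⟩

lemma specialFrom_SE {k : ℕ} {b : Bool} {h : ℤ} {l : List PStep} :
    SpecialFrom k b h (.SE :: l) ↔ h < k ∧ SpecialFrom k false (h - 1) l := by
  rw [specialFrom_cons]
  simp only [stepDy, reduceCtorEq, false_implies, true_or, implies_true, decide_false, true_and,
    ← sub_eq_add_neg]
  refine ⟨fun H => ⟨H.1.2, H.2⟩, fun H => ⟨⟨?_, H.1⟩, H.2⟩⟩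
  have := H.2.nonneg
  omega

lemma specialFrom_S {k : ℕ} {b : Bool} {h : ℤ} {l : List PStep} :
    SpecialFrom k b h (.S :: l) ↔ b = true ∧ h < k ∧ SpecialFrom k false (h - 1) l := by
  rw [specialFrom_cons]
  simp only [stepDy, reduceCtorEq, false_implies, or_true, implies_true, decide_false, true_and,
    ← sub_eq_add_neg, forall_const]
  refine ⟨fun H => ⟨H.2.1, H.1.2, H.2.2⟩, fun H => ⟨⟨?_, H.2.1⟩, H.1, H.2.2⟩⟩
  have := H.2.2.nonneg
  omega

lemma specialFrom_E {k : ℕ} {b : Bool} {h : ℤ} {l : List PStep} :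
    SpecialFrom k b h (.E :: l) ↔ h = 0 ∧ l ≠ [] ∧ SpecialFrom k false 0 l := by
  rw [specialFrom_cons]
  simp only [stepDy, reduceCtorEq, false_implies, or_self, imp_false, decide_false, true_and,
    forall_const, add_zero]
  constructor
  · rintro ⟨-, rfl, h1, h2⟩; exact ⟨rfl, h1, h2⟩
  · rintro ⟨rfl, h1, h2⟩; exact ⟨⟨le_rfl, h2.lt⟩, rfl, h1, h2⟩

lemma specialFrom_NE {k : ℕ} {b : Bool} {h : ℤ} {l : List PStep} :
    SpecialFrom k b h (.NE :: l) ↔ 0 ≤ h ∧ l ≠ [] ∧ SpecialFrom k true (h + 1) l := by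
  rw [specialFrom_cons]
  simp only [stepDy, reduceCtorEq, false_implies, or_self, imp_false, decide_true, true_and]
  refine ⟨fun H => ⟨H.1.1, H.2⟩, fun H => ⟨⟨H.1, ?_⟩, H.2⟩⟩
  have := H.2.2.lt
  omega

/-! ### Peaks and major index of a path with a new first step -/

lemma isPeak_cons_succ (s : PStep) (l : List PStep) (m : ℕ) :
    IsPeak (s :: l) (m + 1) ↔ IsPeak l m := by simp [IsPeak]

lemma numPeaks_eq_sum (l : List PStep) :
    numPeaks l = ∑ m ∈ Finset.range l.length, if IsPeak l m then 1 else 0 := by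
  rw [numPeaks, Finset.card_filter]

lemma numPeaks_cons (s : PStep) (l : List PStep) :
    numPeaks (s :: l) = (if IsPeak (s :: l) 0 then 1 else 0) + numPeaks l := by
  rw [numPeaks_eq_sum, numPeaks_eq_sum, List.length_cons, Finset.sum_range_succ', add_comm]
  simp only [isPeak_cons_succ]

lemma majorIndex_cons (s : PStep) (l : List PStep) :
    majorIndex (s :: l) = (if IsPeak (s :: l) 0 then stepDx s else 0) +
      stepDx s * numPeaks l + majorIndex l := by
  rw [majorIndex, majorIndex, numPeaks_eq_sum, List.length_cons, Finset.sum_range_succ',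
    Finset.mul_sum, add_assoc, ← Finset.sum_add_distrib, add_comm]
  refine congrArg₂ _ (by simp [pathX]) (Finset.sum_congr rfl fun m _ => ?_)
  simp only [isPeak_cons_succ]
  split_ifs <;> simp [pathX]

lemma southSteps_cons (s : PStep) (l : List PStep) :
    southSteps (s :: l) = southSteps l + if s = .S then 1 else 0 := by
  rw [southSteps, southSteps, List.count_cons]
  cases s <;> rfl

lemma numPeaks_nil : numPeaks [] = 0 := rfl

lemma majorIndex_nil : majorIndex [] = 0 := rfl

lemma numPeaks_cons_of_ne {s : PStep} (hs : s ≠ .NE) (l : List PStep) :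
    numPeaks (s :: l) = numPeaks l := by
  simp [numPeaks_cons, IsPeak, hs]

lemma majorIndex_cons_of_ne {s : PStep} (hs : s ≠ .NE) (l : List PStep) :
    majorIndex (s :: l) = stepDx s * numPeaks l + majorIndex l := by
  simp [majorIndex_cons, IsPeak, hs]

lemma numPeaks_NE_NE (l : List PStep) : numPeaks (.NE :: .NE :: l) = numPeaks (.NE :: l) := by
  rw [numPeaks_cons]; simp [IsPeak]

lemma majorIndex_NE_NE (l : List PStep) :
    majorIndex (.NE :: .NE :: l) = numPeaks (.NE :: l) + majorIndex (.NE :: l) := by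
  rw [majorIndex_cons]; simp [IsPeak, stepDx]

lemma numPeaks_NE_SE (l : List PStep) : numPeaks (.NE :: .SE :: l) = numPeaks l + 1 := by
  rw [numPeaks_cons, numPeaks_cons_of_ne (by simp)]; simp [IsPeak, add_comm]

lemma numPeaks_NE_S (l : List PStep) : numPeaks (.NE :: .S :: l) = numPeaks l + 1 := by
  rw [numPeaks_cons, numPeaks_cons_of_ne (by simp)]; simp [IsPeak, add_comm]

lemma majorIndex_NE_SE (l : List PStep) :
    majorIndex (.NE :: .SE :: l) = 2 * numPeaks l + 1 + majorIndex l := by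
  rw [majorIndex_cons, majorIndex_cons_of_ne (by simp), numPeaks_cons_of_ne (by simp)]
  simp [IsPeak, stepDx]
  ring

lemma majorIndex_NE_S (l : List PStep) :
    majorIndex (.NE :: .S :: l) = numPeaks l + 1 + majorIndex l := by
  rw [majorIndex_cons, majorIndex_cons_of_ne (by simp), numPeaks_cons_of_ne (by simp)]
  simp [IsPeak, stepDx]
  ring

/-! ### Weights -/

/-- The weight `q^{2 maj - #S}` of a path. -/
noncomputable def pathWeight (q : ℂ) (l : List PStep) : ℂ :=
  q ^ (2 * (majorIndex l : ℤ) - (southSteps l : ℤ))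

/-- The weight of a path, restricted to special paths from height `h` with `N` peaks. -/
noncomputable def peakTerm (k : ℕ) (q : ℂ) (h : ℤ) (N : ℕ) (l : List PStep) : ℂ :=
  if SpecialFrom k false h l ∧ numPeaks l = N then pathWeight q l else 0

lemma pathWeight_of_shift {q : ℂ} (hq0 : q ≠ 0) {l l' : List PStep} {d : ℕ}
    (h : 2 * (majorIndex l : ℤ) - southSteps l = d + (2 * majorIndex l' - southSteps l')) :
    pathWeight q l = q ^ d * pathWeight q l' := by
  rw [pathWeight, pathWeight, h, zpow_add₀ hq0, zpow_natCast]

lemma peakTerm_shift {k : ℕ} {q : ℂ} (hq0 : q ≠ 0) {h h' : ℤ} {N N' d : ℕ} {l l' : List PStep}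
    (hsp : SpecialFrom k false h l ↔ SpecialFrom k false h' l')
    (hN : numPeaks l = N ↔ numPeaks l' = N')
    (hw : numPeaks l' = N' →
      2 * (majorIndex l : ℤ) - southSteps l = d + (2 * majorIndex l' - southSteps l')) :
    peakTerm k q h N l = q ^ d * peakTerm k q h' N' l' := by
  unfold peakTerm
  by_cases h1 : SpecialFrom k false h' l' ∧ numPeaks l' = N'
  · rw [if_pos h1, if_pos ⟨hsp.mpr h1.1, hN.mpr h1.2⟩, pathWeight_of_shift hq0 (hw h1.2)]
  · rw [if_neg h1, if_neg (by rwa [hsp, hN]), mul_zero]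

lemma peakTerm_eq_zero {k : ℕ} {q : ℂ} {h : ℤ} {N : ℕ} {l : List PStep}
    (hl : ¬ SpecialFrom k false h l) : peakTerm k q h N l = 0 :=
  if_neg fun H => hl H.1

lemma peakTerm_SE {k : ℕ} {q : ℂ} (hq0 : q ≠ 0) {h : ℤ} (hk : h < k) (N : ℕ) (l : List PStep) :
    peakTerm k q h N (.SE :: l) = q ^ (2 * N) * peakTerm k q (h - 1) N l := by
  have e := numPeaks_cons_of_ne (s := .SE) (by simp) l
  refine peakTerm_shift hq0 (by simp [specialFrom_SE, hk]) (by rw [e]) fun hN => ?_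
  rw [majorIndex_cons_of_ne (by simp), southSteps_cons, hN]
  simp [stepDx]; ring

lemma peakTerm_S {k : ℕ} {q : ℂ} (h : ℤ) (N : ℕ) (l : List PStep) :
    peakTerm k q h N (.S :: l) = 0 :=
  peakTerm_eq_zero (by simp [specialFrom_S])

lemma peakTerm_E_of_ne {k : ℕ} {q : ℂ} {h : ℤ} (hh : h ≠ 0) (N : ℕ) (l : List PStep) :
    peakTerm k q h N (.E :: l) = 0 :=
  peakTerm_eq_zero (by simp [specialFrom_E, hh])

lemma peakTerm_nil_of_ne {k : ℕ} {q : ℂ} {h : ℤ} {N : ℕ} (hh : h ≠ 0 ∨ N ≠ 0) :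
    peakTerm k q h N [] = 0 := by
  refine if_neg fun H => ?_
  rw [specialFrom_nil, numPeaks_nil] at H
  omega

lemma peakTerm_E {k : ℕ} {q : ℂ} (hq0 : q ≠ 0) {N : ℕ} (hN0 : N ≠ 0) (l : List PStep) :
    peakTerm k q 0 N (.E :: l) = q ^ (2 * N) * peakTerm k q 0 N l := by
  rcases eq_or_ne l [] with rfl | hl
  · rw [peakTerm_nil_of_ne (Or.inr hN0), peakTerm_eq_zero (by simp [specialFrom_E]), mul_zero]
  have e := numPeaks_cons_of_ne (s := .E) (by simp) l
  refine peakTerm_shift hq0 (by simp [specialFrom_E, hl]) (by rw [e]) fun hN => ?_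
  rw [majorIndex_cons_of_ne (by simp), southSteps_cons, hN]
  simp [stepDx]; ring

lemma peakTerm_NE_NE {k : ℕ} {q : ℂ} (hq0 : q ≠ 0) {h : ℤ} (h0 : 0 ≤ h) (N : ℕ)
    (l : List PStep) :
    peakTerm k q h N (.NE :: .NE :: l) = q ^ (2 * N) * peakTerm k q (h + 1) N (.NE :: l) := by
  refine peakTerm_shift hq0 ?_ (by rw [numPeaks_NE_NE]) fun hN => ?_
  · rw [specialFrom_NE, specialFrom_NE (b := true), specialFrom_NE]
    simp [h0]
  · rw [majorIndex_NE_NE, southSteps_cons, hN]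
    simp; ring

lemma peakTerm_NE_SE {k : ℕ} {q : ℂ} (hq0 : q ≠ 0) {h : ℤ} (h0 : 0 ≤ h) (hk : h + 1 < k) (N : ℕ)
    (l : List PStep) :
    peakTerm k q h (N + 1) (.NE :: .SE :: l) = q ^ (4 * N + 2) * peakTerm k q h N l := by
  refine peakTerm_shift hq0 ?_ (by rw [numPeaks_NE_SE]; omega) fun hN => ?_
  · rw [specialFrom_NE, specialFrom_SE]
    simp [h0, hk]
  · rw [majorIndex_NE_SE, southSteps_cons, southSteps_cons, hN]
    simp; ring

lemma peakTerm_NE_S {k : ℕ} {q : ℂ} (hq0 : q ≠ 0) {h : ℤ} (h0 : 0 ≤ h) (hk : h + 1 < k) (N : ℕ)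
    (l : List PStep) :
    peakTerm k q h (N + 1) (.NE :: .S :: l) = q ^ (2 * N + 1) * peakTerm k q h N l := by
  refine peakTerm_shift hq0 ?_ (by rw [numPeaks_NE_S]; omega) fun hN => ?_
  · rw [specialFrom_NE, specialFrom_S]
    simp [h0, hk]
  · rw [majorIndex_NE_S, southSteps_cons, southSteps_cons, hN]
    simp; ring

lemma peakTerm_NE_E {k : ℕ} {q : ℂ} (h : ℤ) (N : ℕ) (l : List PStep) :
    peakTerm k q h N (.NE :: .E :: l) = 0 := by
  refine peakTerm_eq_zero fun H => ?_
  rw [specialFrom_NE, specialFrom_E] at H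
  omega

lemma peakTerm_NE_nil {k : ℕ} {q : ℂ} (h : ℤ) (N : ℕ) : peakTerm k q h N [.NE] = 0 :=
  peakTerm_eq_zero fun H => (specialFrom_NE.mp H).2.1 rfl

lemma numPeaks_NE_ne_zero {k : ℕ} {b : Bool} {h : ℤ} {l : List PStep}
    (H : SpecialFrom k b h (.NE :: l)) : numPeaks (.NE :: l) ≠ 0 := by
  induction l generalizing b h with
  | nil => exact absurd rfl (specialFrom_NE.mp H).2.1
  | cons s l ih =>
    have H' := specialFrom_NE.mp H
    cases s with
    | NE => rw [numPeaks_NE_NE]; exact ih H'.2.2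
    | SE => rw [numPeaks_NE_SE]; omega
    | S => rw [numPeaks_NE_S]; omega
    | E => have := specialFrom_E.mp H'.2.2; omega

lemma eq_nil_of_numPeaks_eq_zero {k : ℕ} {l : List PStep} (H : SpecialFrom k false 0 l)
    (hN : numPeaks l = 0) : l = [] := by
  induction l with
  | nil => rfl
  | cons s l ih =>
    exfalso
    cases s with
    | NE => exact numPeaks_NE_ne_zero H hN
    | SE => have := (specialFrom_SE.mp H).2.nonneg; omega
    | S => simp [specialFrom_S] at H
    | E =>
      rw [numPeaks_cons_of_ne (by simp)] at hN
      have H' := specialFrom_E.mp H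
      exact H'.2.1 (ih H'.2.2 hN)

/-! ### Summation over paths -/

lemma hasSum_list_cons {F : List PStep → ℂ} {a : PStep → ℂ}
    (h : ∀ s, HasSum (fun l => F (s :: l)) (a s)) :
    HasSum F (F [] + (a .NE + a .SE + a .S + a .E)) := by
  have hext (s : PStep) :
      HasSum (fun l : List PStep => if l.head? = some s then F l else 0) (a s) := by
    have hinj : Function.Injective (List.cons s) := List.cons_injective
    refine (hinj.hasSum_iff fun l hl => ?_).mp ?_
    · refine if_neg fun H => hl ?_
      obtain ⟨t, rfl⟩ := List.head?_eq_some_iff.mp H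
      exact ⟨t, rfl⟩
    · simpa [Function.comp_def] using h s
  have hnil : HasSum (fun l : List PStep => if l = [] then F [] else 0) (F []) :=
    hasSum_ite_eq _ _
  refine (hnil.add ((((hext .NE).add (hext .SE)).add (hext .S)).add (hext .E))).congr_fun ?_
  intro l
  rcases l with _ | ⟨s, l⟩
  · simp
  · cases s <;> simp

lemma replicate_E_append_NE_injective :
    Function.Injective fun p : ℕ × List PStep => List.replicate p.1 PStep.E ++ .NE :: p.2 := by
  rintro ⟨e, l⟩ ⟨e', l'⟩ h
  induction e generalizing e' with
  | zero =>
    cases e' with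
    | zero => simpa using h
    | succ e' => simp [List.replicate_succ] at h
  | succ e ih =>
    cases e' with
    | zero => simp [List.replicate_succ] at h
    | succ e' => simpa using ih e' (by simpa [List.replicate_succ] using h)

lemma hasSum_of_E_geometric {g : List PStep → ℂ} {x c : ℂ} (hx : ‖x‖ < 1) (hnil : g [] = 0)
    (hSE : ∀ l, g (.SE :: l) = 0) (hS : ∀ l, g (.S :: l) = 0) (hE : ∀ l, g (.E :: l) = x * g l)
    (hNE : HasSum (fun l => g (.NE :: l)) c) : HasSum g ((1 - x)⁻¹ * c) := by
  obtain ⟨φ, hφ⟩ : ∃ φ : ℕ × List PStep → List PStep,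
      φ = fun p => List.replicate p.1 .E ++ .NE :: p.2 := ⟨_, rfl⟩
  have hinj : Function.Injective φ := hφ ▸ replicate_E_append_NE_injective
  have hval : ∀ p, g (φ p) = x ^ p.1 * g (.NE :: p.2) := by
    rintro ⟨e, l⟩
    induction e with
    | zero => simp [hφ]
    | succ e ih =>
      have : φ (e + 1, l) = .E :: φ (e, l) := by simp [hφ, List.replicate_succ]
      rw [this, hE, ih, pow_succ']
      ring
  have hout : ∀ l, l ∉ Set.range φ → g l = 0 := by
    intro l hl
    induction l with
    | nil => exact hnil
    | cons s l ih =>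
      cases s with
      | NE => exact absurd ⟨(0, l), by simp [hφ]⟩ hl
      | SE => exact hSE l
      | S => exact hS l
      | E =>
        rw [hE, ih, mul_zero]
        rintro ⟨⟨e, l'⟩, rfl⟩
        exact hl ⟨(e + 1, l'), by simp [hφ, List.replicate_succ]⟩
  rw [← hinj.hasSum_iff hout]
  have hgeo := hasSum_geometric_of_norm_lt_one hx
  have hprod : Summable fun p : ℕ × List PStep => x ^ p.1 * g (.NE :: p.2) :=
    summable_mul_of_summable_norm (f := fun n : ℕ => x ^ n) (g := fun l => g (.NE :: l))
      hgeo.summable.norm hNE.summable.norm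
  have hmul : HasSum (fun p : ℕ × List PStep => x ^ p.1 * g (.NE :: p.2)) ((1 - x)⁻¹ * c) :=
    HasSum.mul (f := fun n : ℕ => x ^ n) (g := fun l => g (.NE :: l)) hgeo hNE hprod
  exact hmul.congr_fun hval

lemma hasSum_peakTerm_NE_zero {k : ℕ} {q : ℂ} (h : ℤ) :
    HasSum (fun l => peakTerm k q h 0 (.NE :: l)) (risingGF k q h 0) := by
  rw [risingGF_zero_right]
  have : (fun l => peakTerm k q h 0 (.NE :: l)) = fun _ => 0 :=
    funext fun l => if_neg fun H => numPeaks_NE_ne_zero H.1 H.2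
  rw [this]
  exact hasSum_zero

lemma hasSum_peakTerm_NE_succ {k : ℕ} {q : ℂ} (hq0 : q ≠ 0) (hq : ‖q‖ < 1) {N : ℕ}
    (hN : ∀ h : ℤ, 0 ≤ h → h < k → HasSum (peakTerm k q h N) (pathGF k q h N)) (d : ℕ) :
    ∀ h : ℤ, 0 ≤ h → h + d + 1 = k →
      HasSum (fun l => peakTerm k q h (N + 1) (.NE :: l)) (risingGF k q h (N + 1)) := by
  induction d with
  | zero =>
    intro h h0 hk
    obtain rfl : h = k - 1 := by push_cast at hk; omega
    rw [risingGF_top]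
    have : (fun l => peakTerm k q (k - 1) (N + 1) (.NE :: l)) = fun _ => 0 :=
      funext fun l => peakTerm_eq_zero fun H => by
        have := (specialFrom_NE.mp H).2.2.lt
        omega
    rw [this]
    exact hasSum_zero
  | succ d ih =>
    intro h h0 hk
    push_cast at hk
    have i1 := (ih (h + 1) (by omega) (by omega)).mul_left (q ^ (2 * (N + 1)))
    have i2 := hN h h0 (by omega)
    let a : PStep → ℂ
      | .NE => q ^ (2 * (N + 1)) * risingGF k q (h + 1) (N + 1)
      | .SE => q ^ (4 * N + 2) * pathGF k q h N
      | .S => q ^ (2 * N + 1) * pathGF k q h N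
      | .E => 0
    have := hasSum_list_cons (F := fun l => peakTerm k q h (N + 1) (.NE :: l)) (a := a) ?_
    · rw [peakTerm_NE_nil] at this
      rw [risingGF_succ hq0 hq]
      convert this using 1
      simp only [a]
      ring
    · intro s
      cases s with
      | NE => exact i1.congr_fun fun l => peakTerm_NE_NE hq0 h0 _ l
      | SE => exact (i2.mul_left _).congr_fun fun l => peakTerm_NE_SE hq0 h0 (by omega) _ l
      | S => exact (i2.mul_left _).congr_fun fun l => peakTerm_NE_S hq0 h0 (by omega) _ l
      | E => exact hasSum_zero.congr_fun fun l => peakTerm_NE_E _ _ l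

lemma hasSum_peakTerm_of_NE {k : ℕ} {q : ℂ} (hq0 : q ≠ 0) (hq : ‖q‖ < 1) {N : ℕ}
    (hNE : ∀ h : ℤ, 0 ≤ h → h < k →
      HasSum (fun l => peakTerm k q h N (.NE :: l)) (risingGF k q h N)) (h : ℕ) (hk : h < k) :
    HasSum (peakTerm k q h N) (pathGF k q h N) := by
  induction h with
  | zero =>
    rcases eq_or_ne N 0 with rfl | hN
    · rw [pathGF_zero_right]
      have h1 : peakTerm k q (0 : ℕ) 0 [] = 1 := by
        unfold peakTerm
        rw [if_pos ⟨specialFrom_nil.mpr ⟨rfl, hk⟩, numPeaks_nil⟩]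
        simp [pathWeight, majorIndex_nil, southSteps]
      rw [← h1]
      exact hasSum_single _ fun l hl => if_neg fun H => hl (eq_nil_of_numPeaks_eq_zero H.1 H.2)
    · have hx : ‖q ^ (2 * N)‖ < 1 := by
        rw [norm_pow]; exact pow_lt_one₀ (norm_nonneg _) hq (by omega)
      have hx1 : 1 - q ^ (2 * N) ≠ 0 := fun H => by
        rw [← sub_eq_zero.mp H, norm_one] at hx
        exact lt_irrefl _ hx
      have e := pathGF_zero_eq (k := k) hq0 hq N
      have : pathGF k q (0 : ℕ) N = (1 - q ^ (2 * N))⁻¹ * risingGF k q 0 N := by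
        rw [eq_inv_mul_iff_mul_eq₀ hx1, Nat.cast_zero]
        linear_combination e
      rw [this, Nat.cast_zero]
      refine hasSum_of_E_geometric hx (peakTerm_nil_of_ne (Or.inr hN)) (fun l => ?_)
        (peakTerm_S _ _) (peakTerm_E hq0 hN) (hNE 0 le_rfl (by exact_mod_cast hk))
      refine peakTerm_eq_zero fun H => ?_
      have := (specialFrom_SE.mp H).2.nonneg
      omega
  | succ h ih =>
    have i1 := (ih (by omega)).mul_left (q ^ (2 * N))
    have hk' : ((h + 1 : ℕ) : ℤ) < k := by exact_mod_cast hk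
    have i2 := hNE (h + 1 : ℕ) (by omega) hk'
    have hh : ((h + 1 : ℕ) : ℤ) - 1 = h := by push_cast; ring
    let a : PStep → ℂ
      | .NE => risingGF k q (h + 1 : ℕ) N
      | .SE => q ^ (2 * N) * pathGF k q h N
      | .S => 0
      | .E => 0
    have := hasSum_list_cons (F := peakTerm k q (h + 1 : ℕ) N) (a := a) ?_
    · rw [peakTerm_nil_of_ne (Or.inl (by omega))] at this
      rw [pathGF_eq hq0 hq, hh]
      convert this using 1
      simp only [a]
      ring
    · intro s
      cases s with
      | NE => exact i2
      | SE => exact i1.congr_fun fun l => by rw [peakTerm_SE hq0 hk', hh]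
      | S => exact hasSum_zero.congr_fun fun l => peakTerm_S _ _ l
      | E => exact hasSum_zero.congr_fun fun l => peakTerm_E_of_ne (by omega) _ l

/-- The generating function of special paths with a given number of peaks. -/
theorem hasSum_peakTerm {k : ℕ} {q : ℂ} (hq0 : q ≠ 0) (hq : ‖q‖ < 1) (N : ℕ) :
    ∀ h : ℤ, 0 ≤ h → h < k → HasSum (peakTerm k q h N) (pathGF k q h N) := by
  induction N with
  | zero =>
    intro h h0 hk
    lift h to ℕ using h0
    exact hasSum_peakTerm_of_NE hq0 hq (fun h _ _ => hasSum_peakTerm_NE_zero h) h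
      (by exact_mod_cast hk)
  | succ N ih =>
    intro h h0 hk
    lift h to ℕ using h0
    refine hasSum_peakTerm_of_NE hq0 hq (fun h h0 hk => ?_) h (by exact_mod_cast hk)
    exact hasSum_peakTerm_NE_succ hq0 hq ih (k - 1 - h).toNat h h0 (by omega)

/-! ### Assembly -/

lemma ofReal_norm_peakTerm (k : ℕ) (q : ℂ) (h : ℤ) (N : ℕ) (l : List PStep) :
    ((‖peakTerm k q h N l‖ : ℝ) : ℂ) = peakTerm k (‖q‖ : ℂ) h N l := by
  unfold peakTerm
  split_ifs
  · simp [pathWeight]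
  · simp

lemma summable_peakTerm {k : ℕ} {q : ℂ} (hq0 : q ≠ 0) (hq : ‖q‖ < 1) {h : ℤ} (h0 : 0 ≤ h)
    (hk : h < k) : Summable fun p : ℕ × List PStep => peakTerm k q h p.1 p.2 := by
  have hr0 : (‖q‖ : ℂ) ≠ 0 := by simpa using hq0
  have hr1 : ‖(‖q‖ : ℂ)‖ < 1 := by simpa using hq
  have hN (N : ℕ) : HasSum (fun l => ‖peakTerm k q h N l‖) (pathGF k (‖q‖ : ℂ) h N).re := by
    have H := Complex.hasSum_re (hasSum_peakTerm hr0 hr1 N h h0 hk)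
    refine H.congr_fun fun l => ?_
    rw [← ofReal_norm_peakTerm, Complex.ofReal_re]
  refine Summable.of_norm ((summable_prod_of_nonneg fun _ => norm_nonneg _).mpr
    ⟨fun N => (hN N).summable, ?_⟩)
  have H := (Complex.hasSum_re (hasSum_pathGF hr0 hr1 h0 hk)).summable
  exact H.congr fun N => (hN N).tsum_eq.symm

lemma hasSum_pathWeight {k : ℕ} {q : ℂ} (hq0 : q ≠ 0) (hq : ‖q‖ < 1) {h : ℤ} (h0 : 0 ≤ h)
    (hk : h < k) :
    HasSum (fun l => if SpecialFrom k false h l then pathWeight q l else 0)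
      (qPochInf (-q) (q ^ 2) * (qPochInf (q ^ 2) (q ^ 2))⁻¹ *
        ∑' n : ℤ, (-1) ^ n * q ^ (2 * k * n ^ 2 + (2 * h + 1) * n)) := by
  have hF := summable_peakTerm hq0 hq h0 hk
  have h1 := hF.hasSum.prod_fiberwise fun N => hasSum_peakTerm hq0 hq N h h0 hk
  rw [(hasSum_pathGF hq0 hq h0 hk).unique h1]
  have h2 : HasSum (fun p : List PStep × ℕ => peakTerm k q h p.2 p.1)
      (∑' p : ℕ × List PStep, peakTerm k q h p.1 p.2) :=
    (Equiv.prodComm (List PStep) ℕ).hasSum_iff.mpr hF.hasSum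
  refine h2.prod_fiberwise fun l => ?_
  have h3 : peakTerm k q h (numPeaks l) l =
      if SpecialFrom k false h l then pathWeight q l else 0 := by simp [peakTerm]
  rw [← h3]
  exact hasSum_single _ fun N hN => if_neg fun H => hN H.2.symm

lemma hasSum_Ebar {k i : ℕ} {q a : ℂ} (hik : i ≤ k)
    (H : HasSum (fun l => if SpecialFrom k false (k - i) l then pathWeight q l else 0) a) :
    HasSum (fun p : ℕ × ℕ => (Ebar k i p.1 p.2 : ℂ) * q ^ (2 * (p.1 : ℤ) - (p.2 : ℤ))) a := by
  have h1 : HasSum (fun x : {l // SpecialPath k i l} => pathWeight q x) a := by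
    refine (hasSum_subtype_iff_indicator (f := pathWeight q) (s := {l | SpecialPath k i l})).mpr ?_
    refine H.congr_fun fun l => ?_
    simp [Set.indicator_apply, specialPath_iff hik]
  set φ : {l // SpecialPath k i l} → ℕ × ℕ :=
    fun x => (majorIndex x.1, southSteps x.1) with hφ
  have h2 := (Equiv.sigmaFiberEquiv φ).hasSum_iff.mpr h1
  refine h2.sigma fun p => ?_
  have hs := h2.summable.sigma_factor p
  have e1 : ∀ x : {x // φ x = p}, pathWeight q x.1.1 = q ^ (2 * (p.1 : ℤ) - (p.2 : ℤ)) := by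
    rintro ⟨x, rfl⟩; rfl
  have e2 : Nat.card {x // φ x = p} = Ebar k i p.1 p.2 :=
    Nat.card_congr
      { toFun := fun x => ⟨x.1.1, x.1.2, congrArg Prod.fst x.2, congrArg Prod.snd x.2⟩
        invFun := fun l => ⟨⟨l.1, l.2.1⟩, Prod.ext l.2.2.1 l.2.2.2⟩
        left_inv := fun _ => rfl
        right_inv := fun _ => rfl }
  have e3 : ∑' x : {x // φ x = p}, pathWeight q x.1.1 =
      (Ebar k i p.1 p.2 : ℂ) * q ^ (2 * (p.1 : ℤ) - (p.2 : ℤ)) := by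
    rw [tsum_congr e1, tsum_const, e2, nsmul_eq_mul]
  rw [← e3]
  exact hs.hasSum

lemma theta_eq_product {k i : ℕ} (hi : 1 ≤ i) (hik : i ≤ k) {q : ℂ} (hq0 : q ≠ 0)
    (hq : ‖q‖ < 1) :
    ∑' n : ℤ, (-1) ^ n * q ^ (2 * k * n ^ 2 + (2 * ((k : ℤ) - i) + 1) * n) =
      qPochInf (q ^ (2 * i - 1)) (q ^ (4 * k)) * qPochInf (q ^ (4 * k + 1 - 2 * i)) (q ^ (4 * k)) *
        qPochInf (q ^ (4 * k)) (q ^ (4 * k)) := by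
  set z : ℂ := q ^ (2 * (k - i) + 1) with hz
  have hz0 : z ≠ 0 := pow_ne_zero _ hq0
  have hp : ‖q ^ (2 * k)‖ < 1 := by
    rw [norm_pow]; exact pow_lt_one₀ (norm_nonneg _) hq (by omega)
  have e (n : ℤ) : (-1 : ℂ) ^ n * q ^ (2 * k * n ^ 2 + (2 * ((k : ℤ) - i) + 1) * n) =
      (-1) ^ n * z ^ n * (q ^ (2 * k)) ^ n ^ 2 := by
    rw [hz, ← zpow_natCast, ← zpow_natCast, ← zpow_mul, ← zpow_mul,
      mul_assoc ((-1 : ℂ) ^ n), ← zpow_add₀ hq0]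
    congr 2
    push_cast [Nat.cast_sub hik]
    ring
  have hs : Summable fun n : ℤ => (-1) ^ n * z ^ n * (q ^ (2 * k)) ^ n ^ 2 :=
    (summable_theta hq0 hq (by omega) (by omega) (by omega)).congr e
  rw [tsum_congr e, jacobi_triple_product (pow_ne_zero _ hq0) hp hz0 hs, ← pow_mul,
    show 2 * k * 2 = 4 * k by ring]
  have e1 : z * q ^ (2 * k) = q ^ (4 * k + 1 - 2 * i) := by
    rw [hz, ← pow_add]; congr 1; omega
  have e2 : z⁻¹ * q ^ (2 * k) = q ^ (2 * i - 1) := by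
    rw [inv_mul_eq_iff_eq_mul₀ hz0, hz, ← pow_add]; congr 1; omega
  rw [e1, e2]
  ring

/-- `(-q;q²)_∞ / (q²;q²)_∞ = (q²;q⁴)_∞ / (q;q)_∞`. -/
lemma qPochInf_neg_div {q : ℂ} (hq : ‖q‖ < 1) :
    qPochInf (-q) (q ^ 2) * (qPochInf (q ^ 2) (q ^ 2))⁻¹ =
      qPochInf (q ^ 2) (q ^ 4) / qPochInf q q := by
  have hq2 := norm_sq_lt_one hq
  have h1 := qPochInf_sq q hq2
  have h2 := qPochInf_eq_even_mul_odd q hq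
  rw [← pow_mul] at h1
  rw [← sq] at h2
  have n0 := qPochInf_ne_zero hq hq
  rw [h2] at n0
  have n1 := left_ne_zero_of_mul n0
  have n2 := right_ne_zero_of_mul n0
  rw [h2, show q ^ 4 = q ^ (2 * 2) by norm_num, h1]
  field_simp

/-- **Corollary 1.6, equation (1.4) (Andrews' generalization of the Göllnitz–Gordon
identities).** For `k ≥ i ≥ 1` and `0 < |q| < 1`,
`Σ_{n,j} Ē_{k,i}(n,j) q^{2n-j} = (q²;q⁴)_∞ (q^{2i-1}, q^{4k+1-2i}, q^{4k}; q^{4k})_∞ / (q;q)_∞`. -/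
theorem gen_fun_E_gollnitz_gordon (k i : ℕ) (hi : 1 ≤ i) (hik : i ≤ k) (q : ℂ)
    (hq0 : 0 < ‖q‖) (hq1 : ‖q‖ < 1) :
    ∑' p : ℕ × ℕ, (Ebar k i p.1 p.2 : ℂ) * q ^ (2 * (p.1 : ℤ) - (p.2 : ℤ)) =
      qPochInf (q ^ 2) (q ^ 4) *
        (qPochInf (q ^ (2 * i - 1)) (q ^ (4 * k)) *
          qPochInf (q ^ (4 * k + 1 - 2 * i)) (q ^ (4 * k)) *
          qPochInf (q ^ (4 * k)) (q ^ (4 * k))) / qPochInf q q := by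
  have hq : q ≠ 0 := norm_pos_iff.mp hq0
  rw [(hasSum_Ebar hik (hasSum_pathWeight hq hq1 (by omega) (by omega))).tsum_eq,
    theta_eq_product hi hik hq hq1, qPochInf_neg_div hq1]
  ring

end Paper
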